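/- Let K be a semifield and i ∈ ℐ. The map f_i : K^ν → 𝒰_K sending a ∈ K^ν to the equivalence class of (i,a) is a bijection. -/

import Mathlib

open scoped BigOperators

namespace Lusztig

variable {I : Type*} [Fintype I] [DecidableEq I]

/-- A simply laced Cartan matrix: symmetric, positive definite, integer entries,
`2` on the diagonal and `0` or `-1` off the diagonal. -/
structure IsSimplyLacedCartan (A : Matrix I I ℤ) : Prop where
  symm : ∀ i j, A i j = A j i
  posDef : ∀ x : I → ℤ, x ≠ 0 → 0 < ∑ i, ∑ j, x i * A i j * x j
  diag : ∀ i, A i i = 2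
  offDiag : ∀ i j, i ≠ j → A i j = 0 ∨ A i j = -1

/-- The simple reflection `s_i` acting on `ℤ[I] = I → ℤ`, `s_i(j') = j' - a_{ij} i'`. -/
def sE (A : Matrix I I ℤ) (i : I) : Function.End (I → ℤ) :=
  fun x => x - (∑ j, A i j * x j) • Pi.single i 1

/-- The length of `w`: the least `n` such that `w` is a product of `n` simple
reflections (`∞` convention: `sInf ∅ = 0`). -/
noncomputable def len (A : Matrix I I ℤ) (w : Function.End (I → ℤ)) : ℕ :=
  sInf {n | ∃ l : List I, l.length = n ∧ (l.map (sE A)).prod = w}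

/-- `w₀` is the longest element of `W = ⟨s_i⟩` and `ν = |w₀|`. -/
structure IsLongest (A : Matrix I I ℤ) (w₀ : Function.End (I → ℤ)) (ν : ℕ) : Prop where
  mem : ∃ l : List I, (l.map (sE A)).prod = w₀
  len_eq : len A w₀ = ν
  longest : ∀ w : Function.End (I → ℤ),
    (∃ l : List I, (l.map (sE A)).prod = w) → len A w ≤ ν

/-- `ℐ`: the set of sequences `(i_1, …, i_ν)` with `s_{i_1} ⋯ s_{i_ν} = w₀`. -/
def RedWord (A : Matrix I I ℤ) (w₀ : Function.End (I → ℤ)) (ν : ℕ) :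
    Set (Fin ν → I) :=
  {f | ((List.ofFn f).map (sE A)).prod = w₀}

/-- The coefficient `r_{h,k}` defined by
`s_{i_1} ⋯ s_{i_{k-1}} (i_k') = Σ_h r_{h,k} h'` (here `k` is `0`-indexed). -/
def rCoef (A : Matrix I I ℤ) {ν : ℕ} (f : Fin ν → I) (h : I) (k : Fin ν) : ℤ :=
  ((List.ofFn fun m : Fin (k : ℕ) => sE A (f (Fin.castLE k.2.le m))).prod :
    Function.End (I → ℤ)) (Pi.single (f k) 1) h

/-- `‖i,a‖_h = Π_k a_k^{r_{h,k}}`. -/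
def normAt (A : Matrix I I ℤ) {ν : ℕ} {K : Type*} [CommGroup K]
    (f : Fin ν → I) (a : Fin ν → K) (h : I) : K :=
  ∏ k : Fin ν, a k ^ rCoef A f h k

section Semifield

variable {K : Type*} [CommGroup K] [AddCommSemigroup K]

/-- Adjacency of two pairs in `ℐ × K^ν`, for a semifield `K` (written
multiplicatively, with addition `+`). -/
def Adjacent (A : Matrix I I ℤ) (w₀ : Function.End (I → ℤ)) (ν : ℕ)
    (p q : (Fin ν → I) × (Fin ν → K)) : Prop :=
  p.1 ∈ RedWord A w₀ ν ∧ q.1 ∈ RedWord A w₀ ν ∧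
  ((∃ (l : ℕ) (h0 : l < ν) (h1 : l + 1 < ν) (h2 : l + 2 < ν),
      A (p.1 ⟨l, h0⟩) (p.1 ⟨l + 1, h1⟩) = -1 ∧
      p.1 ⟨l + 2, h2⟩ = p.1 ⟨l, h0⟩ ∧
      q.1 ⟨l, h0⟩ = p.1 ⟨l + 1, h1⟩ ∧ q.1 ⟨l + 1, h1⟩ = p.1 ⟨l, h0⟩ ∧
      q.1 ⟨l + 2, h2⟩ = p.1 ⟨l + 1, h1⟩ ∧
      (∀ k : Fin ν, (k : ℕ) ≠ l → (k : ℕ) ≠ l + 1 → (k : ℕ) ≠ l + 2 →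
        q.1 k = p.1 k ∧ q.2 k = p.2 k) ∧
      q.2 ⟨l, h0⟩ =
        p.2 ⟨l + 1, h1⟩ * p.2 ⟨l + 2, h2⟩ * (p.2 ⟨l, h0⟩ + p.2 ⟨l + 2, h2⟩)⁻¹ ∧
      q.2 ⟨l + 1, h1⟩ = p.2 ⟨l, h0⟩ + p.2 ⟨l + 2, h2⟩ ∧
      q.2 ⟨l + 2, h2⟩ =
        p.2 ⟨l, h0⟩ * p.2 ⟨l + 1, h1⟩ * (p.2 ⟨l, h0⟩ + p.2 ⟨l + 2, h2⟩)⁻¹) ∨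
   (∃ (l : ℕ) (h0 : l < ν) (h1 : l + 1 < ν),
      A (p.1 ⟨l, h0⟩) (p.1 ⟨l + 1, h1⟩) = 0 ∧
      q.1 ⟨l, h0⟩ = p.1 ⟨l + 1, h1⟩ ∧ q.1 ⟨l + 1, h1⟩ = p.1 ⟨l, h0⟩ ∧
      (∀ k : Fin ν, (k : ℕ) ≠ l → (k : ℕ) ≠ l + 1 →
        q.1 k = p.1 k ∧ q.2 k = p.2 k) ∧
      q.2 ⟨l, h0⟩ = p.2 ⟨l + 1, h1⟩ ∧ q.2 ⟨l + 1, h1⟩ = p.2 ⟨l, h0⟩))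

end Semifield

/-- Adjacency of two pairs in `ℐ × ℤ^ν` for the tropical semifield `ℤ`
(sum = `min`, product = `+`). -/
def TAdjacent (A : Matrix I I ℤ) (w₀ : Function.End (I → ℤ)) (ν : ℕ)
    (p q : (Fin ν → I) × (Fin ν → ℤ)) : Prop :=
  p.1 ∈ RedWord A w₀ ν ∧ q.1 ∈ RedWord A w₀ ν ∧
  ((∃ (l : ℕ) (h0 : l < ν) (h1 : l + 1 < ν) (h2 : l + 2 < ν),
      A (p.1 ⟨l, h0⟩) (p.1 ⟨l + 1, h1⟩) = -1 ∧
      p.1 ⟨l + 2, h2⟩ = p.1 ⟨l, h0⟩ ∧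
      q.1 ⟨l, h0⟩ = p.1 ⟨l + 1, h1⟩ ∧ q.1 ⟨l + 1, h1⟩ = p.1 ⟨l, h0⟩ ∧
      q.1 ⟨l + 2, h2⟩ = p.1 ⟨l + 1, h1⟩ ∧
      (∀ k : Fin ν, (k : ℕ) ≠ l → (k : ℕ) ≠ l + 1 → (k : ℕ) ≠ l + 2 →
        q.1 k = p.1 k ∧ q.2 k = p.2 k) ∧
      q.2 ⟨l, h0⟩ =
        p.2 ⟨l + 1, h1⟩ + p.2 ⟨l + 2, h2⟩ - min (p.2 ⟨l, h0⟩) (p.2 ⟨l + 2, h2⟩) ∧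
      q.2 ⟨l + 1, h1⟩ = min (p.2 ⟨l, h0⟩) (p.2 ⟨l + 2, h2⟩) ∧
      q.2 ⟨l + 2, h2⟩ =
        p.2 ⟨l, h0⟩ + p.2 ⟨l + 1, h1⟩ - min (p.2 ⟨l, h0⟩) (p.2 ⟨l + 2, h2⟩)) ∨
   (∃ (l : ℕ) (h0 : l < ν) (h1 : l + 1 < ν),
      A (p.1 ⟨l, h0⟩) (p.1 ⟨l + 1, h1⟩) = 0 ∧
      q.1 ⟨l, h0⟩ = p.1 ⟨l + 1, h1⟩ ∧ q.1 ⟨l + 1, h1⟩ = p.1 ⟨l, h0⟩ ∧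
      (∀ k : Fin ν, (k : ℕ) ≠ l → (k : ℕ) ≠ l + 1 →
        q.1 k = p.1 k ∧ q.2 k = p.2 k) ∧
      q.2 ⟨l, h0⟩ = p.2 ⟨l + 1, h1⟩ ∧ q.2 ⟨l + 1, h1⟩ = p.2 ⟨l, h0⟩))

section SemifieldIdentities

/-- Closed forms for the parameters after four braid moves leading from the reduced word
`1 3 2 1 3 2` of type `A₃` to the reduced word `2 1 2 3 2 3` with `1` and `3` interchanged. -/
theorem braid_chain_closed_form {F : Type*} [Semifield F]
    (hF : ∀ x y : F, x ≠ 0 → y ≠ 0 → x + y ≠ 0)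
    {a b c d e f x1 x2 x3 y1 y2 y3 z1 z2 z3 w1 w2 w3 : F}
    (ha : a ≠ 0) (hb : b ≠ 0) (hc : c ≠ 0) (hd : d ≠ 0) (he : e ≠ 0) (hf : f ≠ 0)
    (hx1 : x1 = c * e * (b + e)⁻¹) (hx2 : x2 = b + e) (hx3 : x3 = b * c * (b + e)⁻¹)
    (hy1 : y1 = d * f * (x3 + f)⁻¹) (hy2 : y2 = x3 + f) (hy3 : y3 = x3 * d * (x3 + f)⁻¹)
    (hz1 : z1 = x1 * y1 * (a + y1)⁻¹) (hz2 : z2 = a + y1) (hz3 : z3 = a * x1 * (a + y1)⁻¹)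
    (hw1 : w1 = x2 * y2 * (z3 + y2)⁻¹) (hw2 : w2 = z3 + y2)
    (hw3 : w3 = z3 * x2 * (z3 + y2)⁻¹) {P N N' : F}
    (hP : P = a * b * c + f * (a + d) * (b + e)) (hN : N = b * c + f * (b + e))
    (hN' : N' = a * c + f * (a + d)) :
    z1 = c * d * e * f / P ∧ z2 = P / N ∧ w1 = P / N' ∧ w2 = N * N' / P ∧
      y3 = b * c * d / N ∧ w3 = a * c * e / N' := by
  have h1 := hF b e hb he
  have h2 : N ≠ 0 := hN ▸ hF _ _ (mul_ne_zero hb hc) (mul_ne_zero hf h1)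
  have h3 := hF a d ha hd
  have h4 : N' ≠ 0 := hN' ▸ hF _ _ (mul_ne_zero ha hc) (mul_ne_zero hf h3)
  have h5 : P ≠ 0 := hP ▸ hF _ _ (mul_ne_zero (mul_ne_zero ha hb) hc)
    (mul_ne_zero (mul_ne_zero hf h3) h1)
  have ey2 : y2 = N / (b + e) := by
    rw [hy2, hx3, hN]; field_simp
  have ey1 : y1 = d * f * (b + e) / N := by
    rw [hy1, ← hy2, ey2]; field_simp
  have ey3 : y3 = b * c * d / N := by
    rw [hy3, ← hy2, ey2, hx3]; field_simp
  have ez2 : z2 = P / N := by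
    rw [hz2, ey1, eq_div_iff h2, add_mul, div_mul_cancel₀ _ h2, hN, hP]; ring
  have ez1 : z1 = c * d * e * f / P := by
    rw [hz1, ← hz2, ez2, hx1, ey1]; field_simp
  have ez3 : z3 = a * c * e * N / ((b + e) * P) := by
    rw [hz3, ← hz2, ez2, hx1]; field_simp
  have ew2 : w2 = N * N' / P := by
    have : a * c * e + P = (b + e) * N' := by rw [hP, hN']; ring
    have h : z3 + y2 = N * (a * c * e + P) / ((b + e) * P) := by
      rw [ez3, ey2]; field_simp
    rw [hw2, h, this]; field_simp
  have ew1 : w1 = P / N' := by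
    rw [hw1, ← hw2, ew2, hx2, ey2]; field_simp
  have ew3 : w3 = a * c * e / N' := by
    rw [hw3, ← hw2, ew2, hx2, ez3]; field_simp
  exact ⟨ez1, ez2, ew1, ew2, ey3, ew3⟩

/-- Adjoining a zero to a semifield without zero gives a semifield in the sense of Mathlib. -/
@[reducible]
noncomputable def withZeroSemifield (K : Type*) [CommGroup K] [AddCommSemigroup K]
    (hdist : ∀ a b c : K, a * (b + c) = a * b + a * c) : Semifield (WithZero K) :=
  letI : Distrib K :=
    { left_distrib := hdist
      right_distrib := fun a b c => by rw [mul_comm, hdist, mul_comm c, mul_comm c] }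
  { (inferInstance : CommGroupWithZero (WithZero K)),
    (inferInstance : AddCommMonoid (WithZero K)),
    (inferInstance : Distrib (WithZero K)) with
    nnqsmul := _
    nnqsmul_def := fun _ _ => rfl }

variable {K : Type*} [CommGroup K] [AddCommSemigroup K]

theorem braid_hexagon (hdist : ∀ a b c : K, a * (b + c) = a * b + a * c)
    {a b c d e f x1 x2 x3 y1 y2 y3 z1 z2 z3 w1 w2 w3
      x1' x2' x3' y1' y2' y3' z1' z2' z3' w1' w2' w3' : K}
    (hx1 : x1 = c * e * (b + e)⁻¹) (hx2 : x2 = b + e) (hx3 : x3 = b * c * (b + e)⁻¹)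
    (hy1 : y1 = d * f * (x3 + f)⁻¹) (hy2 : y2 = x3 + f) (hy3 : y3 = x3 * d * (x3 + f)⁻¹)
    (hz1 : z1 = x1 * y1 * (a + y1)⁻¹) (hz2 : z2 = a + y1) (hz3 : z3 = a * x1 * (a + y1)⁻¹)
    (hw1 : w1 = x2 * y2 * (z3 + y2)⁻¹) (hw2 : w2 = z3 + y2)
    (hw3 : w3 = z3 * x2 * (z3 + y2)⁻¹)
    (hx1' : x1' = c * d * (a + d)⁻¹) (hx2' : x2' = a + d) (hx3' : x3' = a * c * (a + d)⁻¹)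
    (hy1' : y1' = e * f * (x3' + f)⁻¹) (hy2' : y2' = x3' + f)
    (hy3' : y3' = x3' * e * (x3' + f)⁻¹)
    (hz1' : z1' = x1' * y1' * (b + y1')⁻¹) (hz2' : z2' = b + y1')
    (hz3' : z3' = b * x1' * (b + y1')⁻¹)
    (hw1' : w1' = x2' * y2' * (z3' + y2')⁻¹) (hw2' : w2' = z3' + y2')
    (hw3' : w3' = z3' * x2' * (z3' + y2')⁻¹) :
    z1' = z1 ∧ w1' = z2 ∧ z2' = w1 ∧ w2' = w2 ∧ w3' = y3 ∧ y3' = w3 := by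
  let := withZeroSemifield K hdist
  have hF : ∀ x y : WithZero K, x ≠ 0 → y ≠ 0 → x + y ≠ 0 := by
    intro x y hx hy
    lift x to K using hx
    lift y to K using hy
    exact WithZero.coe_ne_zero (a := x + y)
  have n (x : K) : (x : WithZero K) ≠ 0 := WithZero.coe_ne_zero
  have c' {x y : K} (h : x = y) : (x : WithZero K) = y := congrArg _ h
  obtain ⟨h1, h2, h3, h4, h5, h6⟩ := braid_chain_closed_form hF
    (n a) (n b) (n c) (n d) (n e) (n f) (c' hx1) (c' hx2) (c' hx3) (c' hy1) (c' hy2) (c' hy3)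
    (c' hz1) (c' hz2) (c' hz3) (c' hw1) (c' hw2) (c' hw3) rfl rfl rfl
  obtain ⟨k1, k2, k3, k4, k5, k6⟩ := braid_chain_closed_form hF
    (n b) (n a) (n c) (n e) (n d) (n f)
    (c' hx1') (c' hx2') (c' hx3') (c' hy1') (c' hy2') (c' hy3')
    (c' hz1') (c' hz2') (c' hz3') (c' hw1') (c' hw2') (c' hw3') rfl rfl rfl
  refine ⟨WithZero.coe_inj.1 (k1.trans (.trans ?_ h1.symm)),
    WithZero.coe_inj.1 (k3.trans (.trans ?_ h2.symm)),
    WithZero.coe_inj.1 (k2.trans (.trans ?_ h3.symm)),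
    WithZero.coe_inj.1 (k4.trans (.trans ?_ h4.symm)),
    WithZero.coe_inj.1 (k6.trans (.trans ?_ h5.symm)),
    WithZero.coe_inj.1 (k5.trans (.trans ?_ h6.symm))⟩ <;> ring

end SemifieldIdentities

section Roots

variable (A : Matrix I I ℤ)

/-- The symmetric bilinear form on `ℤ[I]` given by the Cartan matrix. -/
def form (x y : I → ℤ) : ℤ := x ⬝ᵥ (A.mulVec y)

/-- The reflection in a vector of norm `2`. -/
def reflect (β x : I → ℤ) : I → ℤ := x - form A β x • β

/-- The simple root `i'`. -/
abbrev simple (i : I) : I → ℤ := Pi.single i 1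

/-- The action on `ℤ[I]` of the inverse of the product of a word. -/
def invAct : List I → (I → ℤ) → (I → ℤ)
  | [], x => x
  | i :: t, x => invAct t (sE A i x)

/-- A word is reduced if no shorter word has the same product. -/
def IsRed (l : List I) : Prop :=
  ∀ l' : List I, invAct A l' = invAct A l → l.length ≤ l'.length

/-- The roots, as the vectors of norm `2`. -/
def IsRoot (β : I → ℤ) : Prop := form A β β = 2

omit [DecidableEq I] in
theorem form_eq_sum (x y : I → ℤ) : form A x y = ∑ i, ∑ j, x i * A i j * y j := by
  simp [form, dotProduct, Matrix.mulVec, Finset.mul_sum, mul_assoc]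

omit [DecidableEq I] in
theorem form_add_left (x y z : I → ℤ) : form A (x + y) z = form A x z + form A y z := by
  simp [form, add_dotProduct]

omit [DecidableEq I] in
theorem form_add_right (x y z : I → ℤ) : form A x (y + z) = form A x y + form A x z := by
  simp [form, Matrix.mulVec_add]

omit [DecidableEq I] in
theorem form_smul_left (c : ℤ) (x y : I → ℤ) : form A (c • x) y = c * form A x y := by
  rw [form, smul_dotProduct, smul_eq_mul, form]

omit [DecidableEq I] in
theorem form_smul_right (c : ℤ) (x y : I → ℤ) : form A x (c • y) = c * form A x y := by
  rw [form, Matrix.mulVec_smul, dotProduct_smul, smul_eq_mul, form]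

omit [DecidableEq I] in
theorem form_sub_left (x y z : I → ℤ) : form A (x - y) z = form A x z - form A y z := by
  simp [form, sub_dotProduct]

omit [DecidableEq I] in
theorem form_sub_right (x y z : I → ℤ) : form A x (y - z) = form A x y - form A x z := by
  simp [form, Matrix.mulVec_sub]

theorem form_simple_left (i : I) (x : I → ℤ) : form A (simple i) x = ∑ j, A i j * x j := by
  rw [form, simple, single_dotProduct, one_mul]; rfl

theorem form_simple_simple (i j : I) : form A (simple i) (simple j) = A i j := by
  simp [form_simple_left, Pi.single_apply]

theorem sE_eq_reflect (i : I) (x : I → ℤ) : sE A i x = reflect A (simple i) x := by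
  simp [sE, reflect, form_simple_left]

theorem sE_add (i : I) (x y : I → ℤ) : sE A i (x + y) = sE A i x + sE A i y := by
  simp only [sE_eq_reflect, reflect, form_add_right, add_smul]; abel

theorem sE_neg (i : I) (x : I → ℤ) : sE A i (-x) = -sE A i x := by
  have h := sE_add A i x (-x)
  have h0 : sE A i 0 = 0 := by simp [sE]
  rw [add_neg_cancel, h0] at h
  exact (neg_eq_of_add_eq_zero_right h.symm).symm

theorem sE_simple (i j : I) : sE A i (simple j) = simple j - A i j • simple i := by
  rw [sE_eq_reflect, reflect, form_simple_simple]

theorem invAct_add (l : List I) (x y : I → ℤ) :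
    invAct A l (x + y) = invAct A l x + invAct A l y := by
  induction l generalizing x y with
  | nil => rfl
  | cons i t ih => simp only [invAct, sE_add, ih]

theorem invAct_neg (l : List I) (x : I → ℤ) : invAct A l (-x) = -invAct A l x := by
  induction l generalizing x with
  | nil => rfl
  | cons i t ih => simp only [invAct, sE_neg, ih]

variable {A} (hA : IsSimplyLacedCartan A)
include hA

omit [DecidableEq I] in
theorem form_comm (x y : I → ℤ) : form A x y = form A y x := by
  rw [form_eq_sum, form_eq_sum, Finset.sum_comm]
  refine Finset.sum_congr rfl fun i _ => Finset.sum_congr rfl fun j _ => ?_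
  rw [hA.symm j i]; ring

theorem even_form_self (x : I → ℤ) : Even (form A x x) := by
  let φ : (I → ℤ) →+ ZMod 2 :=
    { toFun := fun x => (form A x x : ZMod 2)
      map_zero' := by simp [form]
      map_add' := fun x y => by
        rw [form_add_left, form_add_right, form_add_right, form_comm hA y x]
        push_cast
        have : (2 : ZMod 2) = 0 := rfl
        linear_combination (form A x y : ZMod 2) * this }
  have hφ : φ = 0 := by
    refine AddMonoidHom.functions_ext _ _ _ fun i n => ?_
    have h : form A (Pi.single i n) (Pi.single i n) = 2 * (n * n) := by
      simp [form, hA.diag i]; ring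
    change ((form A (Pi.single i n) (Pi.single i n) : ℤ) : ZMod 2) = 0
    rw [h]
    push_cast
    rw [show (2 : ZMod 2) = 0 from rfl, zero_mul]
  exact (ZMod.intCast_eq_zero_iff_even).1 (DFunLike.congr_fun hφ x)

theorem two_le_form_self {x : I → ℤ} (hx : x ≠ 0) : 2 ≤ form A x x := by
  have h := hA.posDef x hx
  rw [← form_eq_sum] at h
  obtain ⟨k, hk⟩ := even_form_self hA x
  omega

theorem IsRoot.nonneg_or_nonpos {β : I → ℤ} (hβ : IsRoot A β) : 0 ≤ β ∨ β ≤ 0 := by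
  by_contra! h
  have hp : β⁺ ≠ 0 := fun h0 => h.2 (posPart_eq_zero.1 h0)
  have hm : β⁻ ≠ 0 := fun h0 => h.1 (negPart_eq_zero.1 h0)
  have hpm : form A β⁺ β⁻ ≤ 0 := by
    rw [form_eq_sum]
    refine Finset.sum_nonpos fun i _ => Finset.sum_nonpos fun j _ => ?_
    have hi : 0 ≤ β⁺ i := posPart_nonneg β i
    have hj : 0 ≤ β⁻ j := negPart_nonneg β j
    by_cases hij : i = j
    · subst hij
      rcases le_total (β i) 0 with h0 | h0
      · simp [Pi.posPart_apply, posPart_eq_zero.2 h0]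
      · simp [Pi.negPart_apply, negPart_eq_zero.2 h0]
    · rcases hA.offDiag i j hij with h0 | h0 <;> rw [h0]
      · simp
      · nlinarith [mul_nonneg hi hj]
  have h1 := two_le_form_self hA hp
  have h2 := two_le_form_self hA hm
  have h3 : form A β β = form A β⁺ β⁺ + form A β⁻ β⁻ - 2 * form A β⁺ β⁻ := by
    conv_lhs => rw [← posPart_sub_negPart β]
    rw [form_sub_left, form_sub_right, form_sub_right, form_comm hA β⁻ β⁺]; ring
  rw [hβ] at h3
  omega

theorem isRoot_simple (i : I) : IsRoot A (simple i) := by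
  rw [IsRoot, form_simple_simple, hA.diag]

omit [DecidableEq I] in
theorem form_reflect {β : I → ℤ} (hβ : IsRoot A β) (x y : I → ℤ) :
    form A (reflect A β x) (reflect A β y) = form A x y := by
  have h : form A β β = 2 := hβ
  simp only [reflect, form_sub_left, form_sub_right, form_smul_left, form_smul_right, h,
    form_comm hA x β]
  ring

theorem form_sE (i : I) (x y : I → ℤ) : form A (sE A i x) (sE A i y) = form A x y := by
  simp only [sE_eq_reflect, form_reflect hA (isRoot_simple hA i)]

theorem sE_sE (i : I) (x : I → ℤ) : sE A i (sE A i x) = x := by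
  simp only [sE_eq_reflect, reflect, form_sub_right, form_smul_right, form_simple_simple, hA.diag]
  module

theorem sE_simple_self (i : I) : sE A i (simple i) = -simple i := by
  rw [sE_simple, hA.diag]; module

theorem isRoot_invAct (l : List I) {β : I → ℤ} (hβ : IsRoot A β) : IsRoot A (invAct A l β) := by
  induction l generalizing β with
  | nil => exact hβ
  | cons i t ih => exact ih (by rw [IsRoot, form_sE hA]; exact hβ)

theorem sE_nonneg {i : I} {β : I → ℤ} (hβ : IsRoot A β) (h0 : 0 ≤ β) (hi : β ≠ simple i) :
    0 ≤ sE A i β := by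
  refine (IsRoot.nonneg_or_nonpos hA (isRoot_invAct hA [i] hβ)).resolve_right fun h => hi ?_
  have hj : ∀ j, j ≠ i → β j = 0 := by
    intro j hj
    have h1 := h j
    have h2 := h0 j
    simp only [invAct, sE, Pi.sub_apply, Pi.smul_apply, Pi.single_eq_of_ne hj, Pi.zero_apply,
      smul_zero, sub_zero] at h1 h2
    exact le_antisymm h1 h2
  have hβi : β = β i • simple i := by
    ext j
    by_cases hji : j = i
    · subst hji; simp
    · simp [hj j hji, hji]
  have hn : β i * (β i * 2) = 2 := by
    have h2 : form A β β = 2 := hβ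
    rwa [hβi, form_smul_left, form_smul_right, form_simple_simple, hA.diag] at h2
  have h1 : β i = 1 := by
    have := h0 i
    simp only [Pi.zero_apply] at this
    nlinarith
  rw [hβi, h1, one_smul]

theorem reflect_sE (i : I) (β x : I → ℤ) :
    reflect A (sE A i β) (sE A i x) = sE A i (reflect A β x) := by
  rw [reflect, form_sE hA]
  simp only [sE_eq_reflect, reflect, form_sub_right, form_smul_right, sub_smul, mul_smul, smul_sub]
  abel

/-- The exchange property. -/
theorem exists_exchange (l : List I) {β : I → ℤ} (hβ : IsRoot A β) (h0 : 0 ≤ β)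
    (hl : invAct A l β ≤ 0) :
    ∃ l' : List I, l'.length + 1 = l.length ∧
      ∀ x, invAct A l' x = invAct A l (reflect A β x) := by
  induction l generalizing β with
  | nil =>
    have : β = 0 := le_antisymm hl h0
    rw [this] at hβ
    simp [IsRoot, form] at hβ
  | cons j t ih =>
    by_cases hj : β = simple j
    · refine ⟨t, rfl, fun x => ?_⟩
      rw [hj, ← sE_eq_reflect, invAct, sE_sE hA]
    · obtain ⟨t', ht, h⟩ := ih (isRoot_invAct hA [j] hβ) (sE_nonneg hA hβ h0 hj) hl
      refine ⟨j :: t', by simpa using ht, fun x => ?_⟩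
      rw [invAct, invAct, h, ← reflect_sE hA, invAct, invAct]

theorem invAct_cons_injective {i : I} {t t' : List I}
    (h : invAct A (i :: t) = invAct A (i :: t')) : invAct A t = invAct A t' := by
  funext x
  have := congrFun h (sE A i x)
  simpa only [invAct, sE_sE hA] using this

omit hA in
theorem invAct_cons_congr (i : I) {t t' : List I} (h : invAct A t = invAct A t') :
    invAct A (i :: t) = invAct A (i :: t') := by
  funext x
  simp only [invAct, h]

omit hA in
theorem IsRed.tail {i : I} {t : List I} (h : IsRed A (i :: t)) : IsRed A t := by
  intro l' hl
  simpa using h (i :: l') (invAct_cons_congr i hl)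

omit hA in
theorem IsRed.of_eq {l l' : List I} (h : IsRed A l) (he : invAct A l' = invAct A l)
    (hlen : l'.length = l.length) : IsRed A l' := by
  intro m hm
  rw [hlen]
  exact h m (hm.trans he)

theorem IsRed.invAct_simple_nonpos {i : I} {t : List I} (h : IsRed A (i :: t)) :
    invAct A (i :: t) (simple i) ≤ 0 := by
  rcases IsRoot.nonneg_or_nonpos hA (isRoot_invAct hA t (isRoot_simple hA i)) with h0 | h0
  · rw [invAct, sE_simple_self hA, invAct_neg]
    exact neg_nonpos.2 h0
  · obtain ⟨l', hl, hx⟩ := exists_exchange hA t (isRoot_simple hA i)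
      (by intro j; by_cases hj : j = i <;> simp [hj]) h0
    have := h l' (funext fun x => by rw [hx, invAct, sE_eq_reflect])
    simp at this
    omega

theorem exists_cons {l : List I} {i : I} (hi : invAct A l (simple i) ≤ 0) :
    ∃ t : List I, invAct A (i :: t) = invAct A l ∧ (i :: t).length = l.length := by
  obtain ⟨l', hl, hx⟩ := exists_exchange hA l (isRoot_simple hA i)
      (by intro j; by_cases hj : j = i <;> simp [hj]) hi
  refine ⟨l', funext fun x => ?_, hl⟩
  rw [invAct, hx, ← sE_eq_reflect, sE_sE hA]

omit hA in
variable (A) in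
/-- The condition that `z` can be completed to a reduced word of an element whose inverse acts
as `f`. -/
def NegSeq : ((I → ℤ) → (I → ℤ)) → List I → Prop
  | _, [] => True
  | f, i :: z => f (simple i) ≤ 0 ∧ NegSeq (fun x => f (sE A i x)) z

theorem exists_append {l : List I} (z : List I) (hz : NegSeq A (invAct A l) z) :
    ∃ r : List I, invAct A (z ++ r) = invAct A l ∧ (z ++ r).length = l.length := by
  induction z generalizing l with
  | nil => exact ⟨l, rfl, rfl⟩
  | cons i z ih =>
    obtain ⟨t, ht, hlen⟩ := exists_cons hA hz.1
    have hact : invAct A t = fun x => invAct A l (sE A i x) := by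
      funext x
      rw [← ht, invAct, sE_sE hA]
    obtain ⟨r, hr, hr'⟩ := ih (hact ▸ hz.2)
    refine ⟨r, (invAct_cons_congr i hr).trans ht, ?_⟩
    simpa using (congrArg (· + 1) hr').trans hlen

omit hA in
theorem sE_simple_adj {i j : I} (h : A i j = -1) : sE A i (simple j) = simple j + simple i := by
  rw [sE_simple, h]; module

omit hA in
theorem sE_simple_comm {i j : I} (h : A i j = 0) : sE A i (simple j) = simple j := by
  rw [sE_simple, h]; module

theorem sE_braid {i j : I} (h : A i j = -1) (x : I → ℤ) :
    sE A i (sE A j (sE A i x)) = sE A j (sE A i (sE A j x)) := by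
  have h' : A j i = -1 := by rw [← hA.symm, h]
  simp only [sE_eq_reflect, reflect, form_sub_right, form_smul_right, form_simple_simple, hA.diag,
    h, h']
  module

theorem sE_comm {i j : I} (h : A i j = 0) (x : I → ℤ) :
    sE A i (sE A j x) = sE A j (sE A i x) := by
  have h' : A j i = 0 := by rw [← hA.symm, h]
  simp only [sE_eq_reflect, reflect, form_sub_right, form_smul_right, form_simple_simple, h, h']
  module

end Roots

section Moves

variable (A : Matrix I I ℤ)
variable {K : Type*} [CommGroup K] [AddCommSemigroup K]

/-- A braid or commutation move at the head of a decorated word. -/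
inductive Flip : List (I × K) → List (I × K) → Prop
  | braid {i j : I} (h : A i j = -1) (a b c : K) (t : List (I × K)) :
      Flip ((i, a) :: (j, b) :: (i, c) :: t)
        ((j, b * c * (a + c)⁻¹) :: (i, a + c) :: (j, a * b * (a + c)⁻¹) :: t)
  | comm {i j : I} (h : A i j = 0) (a b : K) (t : List (I × K)) :
      Flip ((i, a) :: (j, b) :: t) ((j, b) :: (i, a) :: t)

/-- A braid or commutation move anywhere in a decorated word. -/
inductive Move : List (I × K) → List (I × K) → Prop
  | head {p q : List (I × K)} (h : Flip A p q) : Move p q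
  | cons (x : I × K) {p q : List (I × K)} (h : Move p q) : Move (x :: p) (x :: q)

/-- Decorated words connected by moves. -/
abbrev Conn : List (I × K) → List (I × K) → Prop := Relation.ReflTransGen (Move A)

/-- The word underlying a decorated word. -/
abbrev word (p : List (I × K)) : List I := p.map Prod.fst

/-- Decorated words with the same first entry and connected tails. -/
def TailConn (p q : List (I × K)) : Prop :=
  ∃ x t t', p = x :: t ∧ q = x :: t' ∧ Conn A t t'

/-- Connectedness with at most one move involving the first letter. -/
def OneFlip (p q : List (I × K)) : Prop :=
  TailConn A p q ∨ ∃ p' q', TailConn A p p' ∧ Flip A p' q' ∧ TailConn A q' q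

/-- The decorated word `p` has first letter `i`. -/
def Starts (p : List (I × K)) (i : I) : Prop := ∃ a t, p = (i, a) :: t

variable {A}

omit [Fintype I] [DecidableEq I] [CommGroup K] [AddCommSemigroup K] in
theorem word_eq_cons {p : List (I × K)} {i : I} {l : List I} :
    word p = i :: l ↔ ∃ a t, p = (i, a) :: t ∧ word t = l := by
  rcases p with _ | ⟨⟨i, a⟩, t⟩
  · simp
  · simp [and_assoc, eq_comm]

omit [Fintype I] [DecidableEq I] [CommGroup K] [AddCommSemigroup K] in
theorem Starts.unique {p : List (I × K)} {i j : I} (h : Starts p i) (h' : Starts p j) : i = j := by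
  obtain ⟨a, t, rfl⟩ := h
  obtain ⟨b, t', h⟩ := h'
  simp only [List.cons.injEq, Prod.mk.injEq] at h
  exact h.1.1

omit [Fintype I] [DecidableEq I] in
theorem Conn.cons (x : I × K) {p q : List (I × K)} (h : Conn A p q) :
    Conn A (x :: p) (x :: q) :=
  Relation.ReflTransGen.lift (x :: ·) (fun _ _ h => Move.cons x h) _ _ h

omit [Fintype I] [DecidableEq I] in
theorem TailConn.conn {p q : List (I × K)} (h : TailConn A p q) : Conn A p q := by
  obtain ⟨x, t, t', rfl, rfl, h⟩ := h
  exact h.cons x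

omit [Fintype I] [DecidableEq I] in
theorem OneFlip.conn {p q : List (I × K)} (h : OneFlip A p q) : Conn A p q := by
  rcases h with h | ⟨p', q', h, h', h''⟩
  · exact h.conn
  · exact (h.conn.tail (.head h')).trans h''.conn

omit [Fintype I] [DecidableEq I] in
theorem TailConn.trans {p q r : List (I × K)} (h : TailConn A p q) (h' : TailConn A q r) :
    TailConn A p r := by
  obtain ⟨x, t, t', rfl, rfl, h⟩ := h
  obtain ⟨y, u, u', h1, rfl, h'⟩ := h'
  obtain ⟨rfl, rfl⟩ := List.cons.inj h1
  exact ⟨_, _, _, rfl, rfl, h.trans h'⟩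

omit [Fintype I] [DecidableEq I] in
theorem TailConn.starts {p q : List (I × K)} (h : TailConn A p q) {i : I} (hp : Starts p i) :
    Starts q i := by
  obtain ⟨x, t, t', rfl, rfl, -⟩ := h
  obtain ⟨a, u, h⟩ := hp
  exact ⟨a, t', by rw [(List.cons.inj h).1]⟩

omit [Fintype I] [DecidableEq I] in
theorem TailConn.oneFlip_trans {p q r : List (I × K)} (h : TailConn A p q) (h' : OneFlip A q r) :
    OneFlip A p r := by
  rcases h' with h' | ⟨p', q', h1, h2, h3⟩
  · exact .inl (h.trans h')
  · exact .inr ⟨p', q', h.trans h1, h2, h3⟩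

omit [Fintype I] [DecidableEq I] in
theorem OneFlip.tailConn_trans {p q r : List (I × K)} (h : OneFlip A p q) (h' : TailConn A q r) :
    OneFlip A p r := by
  rcases h with h | ⟨p', q', h1, h2, h3⟩
  · exact .inl (h.trans h')
  · exact .inr ⟨p', q', h1, h2, h3.trans h'⟩

section Semifield

variable (hA : IsSimplyLacedCartan A) (hdist : ∀ a b c : K, a * (b + c) = a * b + a * c)

include hA in
theorem Flip.word {p q : List (I × K)} (h : Flip A p q) :
    invAct A (word p) = invAct A (word q) ∧ p.length = q.length := by
  cases h with
  | braid h => exact ⟨funext fun x => by simp only [List.map_cons, invAct, sE_braid hA h], rfl⟩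
  | comm h => exact ⟨funext fun x => by simp only [List.map_cons, invAct, sE_comm hA h], rfl⟩

include hA in
theorem Move.word {p q : List (I × K)} (h : Move A p q) :
    invAct A (word p) = invAct A (word q) ∧ p.length = q.length := by
  induction h with
  | head h => exact h.word hA
  | cons x h ih => exact ⟨invAct_cons_congr _ ih.1, congrArg (· + 1) ih.2⟩

include hA in
theorem Conn.word {p q : List (I × K)} (h : Conn A p q) :
    invAct A (word p) = invAct A (word q) ∧ p.length = q.length := by
  induction h with
  | refl => exact ⟨rfl, rfl⟩
  | tail _ h ih => exact ⟨ih.1.trans (h.word hA).1, ih.2.trans (h.word hA).2⟩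

include hA in
theorem Conn.isRed {p q : List (I × K)} (h : Conn A p q) (hp : IsRed A (Lusztig.word p)) :
    IsRed A (Lusztig.word q) :=
  hp.of_eq (h.word hA).1.symm (by simpa using (h.word hA).2.symm)

include hA hdist

omit [DecidableEq I] in
theorem Flip.symm {p q : List (I × K)} (h : Flip A p q) : Flip A q p := by
  cases h with
  | @braid i j h a b c t =>
    have hb : b * c * (a + c)⁻¹ + a * b * (a + c)⁻¹ = b := by
      have h1 : b * c * (a + c)⁻¹ + a * b * (a + c)⁻¹ = (b * (a + c)⁻¹) * (a + c) := by
        rw [hdist, add_comm]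
        congr 1
        · rw [mul_comm a b, mul_right_comm]
        · rw [mul_right_comm]
      rw [h1, inv_mul_cancel_right]
    have h2 := Flip.braid (A := A) (i := j) (j := i) (by rw [← hA.symm, h])
      (b * c * (a + c)⁻¹) (a + c) (a * b * (a + c)⁻¹) t
    rw [hb] at h2
    convert h2 using 3
    · rw [mul_inv_cancel_comm_assoc, mul_inv_cancel_right]
    · congr 2
      rw [inv_mul_cancel_right, mul_comm b c, mul_inv_cancel_right]
  | comm h => exact .comm (by rw [← hA.symm, h]) _ _ _

omit [DecidableEq I] in
theorem Move.symm {p q : List (I × K)} (h : Move A p q) : Move A q p := by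
  induction h with
  | head h => exact .head (h.symm hA hdist)
  | cons x h ih => exact .cons x ih

omit [DecidableEq I] in
theorem Conn.symm {p q : List (I × K)} (h : Conn A p q) : Conn A q p := by
  have : Std.Symm (Move (K := K) A) := ⟨fun _ _ h => Move.symm hA hdist h⟩
  exact Std.Symm.symm _ _ h

omit [DecidableEq I] in
theorem TailConn.symm {p q : List (I × K)} (h : TailConn A p q) : TailConn A q p := by
  obtain ⟨x, t, t', rfl, rfl, h⟩ := h
  exact ⟨x, t', t, rfl, rfl, h.symm hA hdist⟩

omit [DecidableEq I] in
theorem OneFlip.symm {p q : List (I × K)} (h : OneFlip A p q) : OneFlip A q p := by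
  rcases h with h | ⟨p', q', h1, h2, h3⟩
  · exact .inl (h.symm hA hdist)
  · exact .inr ⟨q', p', h3.symm hA hdist, h2.symm hA hdist, h1.symm hA hdist⟩

omit hdist in
/-- Two left descents of a reduced word can be brought to the front. -/
theorem exists_word_flip {l : List I} {i j : I} (hij : i ≠ j)
    (hi : invAct A l (simple i) ≤ 0) (hj : invAct A l (simple j) ≤ 0) :
    (A i j = -1 ∧ ∃ r, invAct A (i :: j :: i :: r) = invAct A l ∧
        (i :: j :: i :: r).length = l.length) ∨
      (A i j = 0 ∧ ∃ r, invAct A (i :: j :: r) = invAct A l ∧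
        (i :: j :: r).length = l.length) := by
  rcases hA.offDiag i j hij with h | h
  · refine .inr ⟨h, exists_append hA [i, j] ⟨hi, ?_, trivial⟩⟩
    beta_reduce
    rwa [sE_simple_comm h]
  · have h' : A j i = -1 := by rw [← hA.symm, h]
    refine .inl ⟨h, exists_append hA [i, j, i] ⟨hi, ?_, ?_, trivial⟩⟩
    · beta_reduce
      rw [sE_simple_adj h, invAct_add]
      exact add_nonpos hj hi
    · beta_reduce
      rwa [sE_simple_adj h', sE_add, sE_simple_self hA, sE_simple_adj h, neg_add_cancel_comm_assoc]

omit hdist in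
/-- Matsumoto's theorem for decorated words. -/
theorem exists_conn (p : List (I × K)) (hp : IsRed A (word p)) (g : List I)
    (hg : invAct A g = invAct A (word p)) (hlen : g.length = p.length) :
    ∃ q, word q = g ∧ Conn A p q := by
  induction hn : p.length generalizing p g with
  | zero =>
    have h1 := List.length_eq_zero_iff.1 hn
    have h2 := List.length_eq_zero_iff.1 (hlen.trans hn)
    exact ⟨[], by simp [h2], by rw [h1]⟩
  | succ n ih =>
    obtain ⟨⟨i, a⟩, p, rfl⟩ := List.exists_cons_of_length_eq_add_one hn
    obtain ⟨j, g, rfl⟩ := List.exists_cons_of_length_eq_add_one (hlen.trans hn)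
    have key : ∀ (i : I) (a : K) (p : List (I × K)) (g : List I), IsRed A (i :: word p) →
        invAct A (i :: g) = invAct A (i :: word p) → g.length = p.length → p.length = n →
        ∃ q, word q = i :: g ∧ Conn A ((i, a) :: p) q := by
      intro i a p g hp hg hlen hn
      obtain ⟨q, rfl, hq⟩ := ih p hp.tail g (invAct_cons_injective hA hg) hlen hn
      exact ⟨(i, a) :: q, rfl, hq.cons _⟩
    simp only [List.length_cons, Nat.add_right_cancel_iff] at hlen hn
    by_cases hij : i = j
    · subst hij
      exact key i a p g hp hg hlen hn
    · have hg' : IsRed A (j :: g) := hp.of_eq hg (by simp [hlen])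
      have hj := hg'.invAct_simple_nonpos hA
      rw [hg] at hj
      suffices h : ∃ q q' : List (I × K), Conn A ((i, a) :: p) q ∧ Flip A q q' ∧ Starts q' j by
        obtain ⟨q, q', h1, h2, b, t, rfl⟩ := h
        have h3 : Conn A ((i, a) :: p) ((j, b) :: t) := h1.tail (.head h2)
        obtain ⟨h4, h5⟩ := h3.word hA
        simp only [List.length_cons, Nat.add_right_cancel_iff] at h5
        obtain ⟨r, h6, h7⟩ := key j b t g (h3.isRed hA hp) (hg.trans h4) (hlen.trans h5)
          (h5.symm.trans hn)
        exact ⟨r, h6, h3.trans h7⟩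
      rcases exists_word_flip hA hij (hp.invAct_simple_nonpos hA) hj with
        ⟨h, r, h1, h2⟩ | ⟨h, r, h1, h2⟩
      · obtain ⟨q, hq, hc⟩ := key i a p (j :: i :: r) hp h1 (by simpa using h2) hn
        simp only [word_eq_cons] at hq
        obtain ⟨a', _, rfl, b', _, rfl, c', u, rfl, -⟩ := hq
        exact ⟨_, _, hc, .braid h _ _ _ _, _, _, rfl⟩
      · obtain ⟨q, hq, hc⟩ := key i a p (j :: r) hp h1 (by simpa using h2) hn
        simp only [word_eq_cons] at hq
        obtain ⟨a', _, rfl, b', u, rfl, -⟩ := hq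
        exact ⟨_, _, hc, .comm h _ _ _, _, _, rfl⟩

omit [DecidableEq I] hdist in
theorem Flip.starts_ne {p q : List (I × K)} (h : Flip A p q) {i : I} (hp : Starts p i) :
    ¬ Starts q i := by
  intro hq
  have := hA.diag i
  cases h with
  | braid h =>
    obtain rfl := hp.unique ⟨_, _, rfl⟩
    obtain rfl := hq.unique ⟨_, _, rfl⟩
    omega
  | comm h =>
    obtain rfl := hp.unique ⟨_, _, rfl⟩
    obtain rfl := hq.unique ⟨_, _, rfl⟩
    omega

/-- Injectivity of the parametrization for words of length less than `n`. -/
def InjBelow (A : Matrix I I ℤ) (K : Type*) [CommGroup K] [AddCommSemigroup K] (n : ℕ) : Prop :=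
  ∀ p q : List (I × K), p.length < n → IsRed A (word p) → Conn A p q → word p = word q → p = q

theorem InjBelow.cons_inj {n : ℕ} (hn : InjBelow A K n) {i : I} {a b : K} {t u : List (I × K)}
    (hlen : t.length + 1 < n) (hred : IsRed A (i :: word t))
    (h : Conn A ((i, a) :: t) ((i, b) :: u)) : a = b ∧ Conn A t u := by
  obtain ⟨h1, h2⟩ := h.word hA
  obtain ⟨v, hv, hc⟩ := exists_conn hA t hred.tail (word u)
    (invAct_cons_injective hA h1.symm) (by simpa using h2.symm)
  have h3 := hn ((i, a) :: v) ((i, b) :: u) (by simpa [← (hc.word hA).2] using hlen)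
    ((hc.cons (i, a)).isRed hA hred) (((hc.cons (i, a)).symm hA hdist).trans h) (by simp [hv])
  simp only [List.cons.injEq, Prod.mk.injEq, true_and] at h3
  exact ⟨h3.1, h3.2 ▸ hc⟩

theorem InjBelow.flip {n : ℕ} (hn : InjBelow A K n) {p p' q q' : List (I × K)}
    (hlen : p.length ≤ n) (hred : IsRed A (word p)) (h : TailConn A p p')
    (hq : Flip A p q) (hq' : Flip A p' q') {j : I} (hj : Starts q j) (hj' : Starts q' j) :
    TailConn A q q' := by
  obtain ⟨x, t, t', rfl, rfl, h⟩ := h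
  cases hq with
  | @braid i k hik a b c t =>
    obtain rfl := hj.unique ⟨_, _, rfl⟩
    have hred' := hred.tail
    simp only [List.length_cons] at hlen
    cases hq' with
    | braid hik' a b' c' t' =>
      obtain rfl := hj'.unique ⟨_, _, rfl⟩
      obtain ⟨rfl, h1⟩ := hn.cons_inj hA hdist (by simp only [List.length_cons]; omega) hred' h
      obtain ⟨rfl, h2⟩ := hn.cons_inj hA hdist (by omega) hred'.tail h1
      exact ⟨_, _, _, rfl, rfl, (h2.cons _).cons _⟩
    | comm hik' a b' t' =>
      obtain rfl := hj'.unique ⟨_, _, rfl⟩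
      omega
  | @comm i k hik a b t =>
    obtain rfl := hj.unique ⟨_, _, rfl⟩
    have hred' := hred.tail
    simp only [List.length_cons] at hlen
    cases hq' with
    | braid hik' a b' c' t' =>
      obtain rfl := hj'.unique ⟨_, _, rfl⟩
      omega
    | comm hik' a b' t' =>
      obtain rfl := hj'.unique ⟨_, _, rfl⟩
      obtain ⟨rfl, h1⟩ := hn.cons_inj hA hdist (by omega) hred' h
      exact ⟨_, _, _, rfl, rfl, h1.cons _⟩

omit [DecidableEq I] in
theorem OneFlip.tailConn {p q : List (I × K)} (h : OneFlip A p q) {i : I} (hp : Starts p i)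
    (hq : Starts q i) : TailConn A p q := by
  rcases h with h | ⟨p', q', h1, h2, h3⟩
  · exact h
  · exact (h2.starts_ne hA (h1.starts hp) ((h3.symm hA hdist).starts hq)).elim

theorem InjBelow.oneFlip_unique {n : ℕ} (hn : InjBelow A K n) {p q q' : List (I × K)}
    (hlen : p.length ≤ n) (hred : IsRed A (word p)) (h : OneFlip A p q) (h' : OneFlip A p q')
    {j : I} (hj : Starts q j) (hj' : Starts q' j) : TailConn A q q' := by
  rcases h with h | ⟨p1, q1, h1, h2, h3⟩
  · exact (h.symm hA hdist).trans (h'.tailConn hA hdist ((h.symm hA hdist).starts hj) hj')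
  · rcases h' with h' | ⟨p2, q2, h4, h5, h6⟩
    · exact (h2.starts_ne hA (h1.starts ((h'.symm hA hdist).starts hj'))
        ((h3.symm hA hdist).starts hj)).elim
    · have h7 := hn.flip hA hdist ((h1.conn.word hA).2 ▸ hlen) (h1.conn.isRed hA hred)
        ((h1.symm hA hdist).trans h4) h2 h5 ((h3.symm hA hdist).starts hj)
        ((h6.symm hA hdist).starts hj')
      exact ((h3.symm hA hdist).trans h7).trans h6

omit hdist in
/-- A reduced word with the same first letter and the same product is reached without changing the
first entry. -/
theorem exists_tailConn {p : List (I × K)} {i : I} {g : List I} (hp : Starts p i)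
    (hred : IsRed A (word p)) (hg : invAct A (i :: g) = invAct A (word p))
    (hlen : (i :: g).length = p.length) :
    ∃ q, word q = i :: g ∧ TailConn A p q := by
  obtain ⟨a, t, rfl⟩ := hp
  obtain ⟨u, rfl, hc⟩ := exists_conn hA t hred.tail g (invAct_cons_injective hA hg)
    (by simpa using hlen)
  exact ⟨(i, a) :: u, rfl, _, _, _, rfl, rfl, hc⟩

omit [CommGroup K] [AddCommSemigroup K] hdist in
theorem Starts.nonpos {p : List (I × K)} (hred : IsRed A (Lusztig.word p)) {i : I}
    (hp : Starts p i) : invAct A (Lusztig.word p) (simple i) ≤ 0 := by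
  obtain ⟨a, t, rfl⟩ := hp
  exact hred.invAct_simple_nonpos hA

omit hdist in
theorem exists_oneFlip {p : List (I × K)} {i j : I} (hp : Starts p i) (hred : IsRed A (word p))
    (hij : i ≠ j) (hj : invAct A (word p) (simple j) ≤ 0) :
    ∃ q, Starts q j ∧ OneFlip A p q := by
  rcases exists_word_flip hA hij (hp.nonpos hA hred) hj with
    ⟨h, r, h1, h2⟩ | ⟨h, r, h1, h2⟩
  · obtain ⟨q, hq, hc⟩ := exists_tailConn hA hp hred h1 (by simpa using h2)
    simp only [word_eq_cons] at hq
    obtain ⟨a', _, rfl, b', _, rfl, c', u, rfl, -⟩ := hq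
    exact ⟨_, ⟨_, _, rfl⟩, .inr ⟨_, _, hc, .braid h _ _ _ _, ⟨_, _, _, rfl, rfl, .refl⟩⟩⟩
  · obtain ⟨q, hq, hc⟩ := exists_tailConn hA hp hred h1 (by simpa using h2)
    simp only [word_eq_cons] at hq
    obtain ⟨a', _, rfl, b', u, rfl, -⟩ := hq
    exact ⟨_, ⟨_, _, rfl⟩, .inr ⟨_, _, hc, .comm h _ _ _, ⟨_, _, _, rfl, rfl, .refl⟩⟩⟩

/-- Consistency of changing the first letter along `i`, `j`, `k`. -/
def TransAt (A : Matrix I I ℤ) (K : Type*) [CommGroup K] [AddCommSemigroup K] (n : ℕ)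
    (i j k : I) : Prop :=
  ∀ p q r : List (I × K), p.length = n → IsRed A (word p) → Starts p i → Starts q j →
    Starts r k → OneFlip A p q → OneFlip A q r → OneFlip A p r

theorem TransAt.rotate {n : ℕ} (hn : InjBelow A K n) {i j k : I} (hij : i ≠ j) (hjk : j ≠ k)
    (h : TransAt A K n i j k) : TransAt A K n j k i := by
  intro p q r hlen hred hp hq hr hpq hqr
  have hpr : Conn A p r := hpq.conn.trans hqr.conn
  have hrred := hpr.isRed hA hred
  have hrlen : r.length = n := (hpr.word hA).2 ▸ hlen
  obtain ⟨p', hp', hrp⟩ := exists_oneFlip hA hr hrred hij (by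
    rw [← (hpr.word hA).1]; exact hp.nonpos hA hred)
  have hpred' := hrp.conn.isRed hA hrred
  have hqred := hpq.conn.isRed hA hred
  obtain ⟨q', hq', hpq'⟩ := exists_oneFlip hA hp' hpred' hjk (by
    rw [← (hrp.conn.word hA).1, ← (hqr.conn.word hA).1]; exact hq.nonpos hA hqred)
  have hrq := h r p' q' hrlen hrred hr hp' hq' hrp hpq'
  have hqq := hn.oneFlip_unique hA hdist hrlen.le hrred (hqr.symm hA hdist) hrq hq hq'
  have hqp : OneFlip A q p' := hqq.oneFlip_trans (hpq'.symm hA hdist)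
  have hpp := hn.oneFlip_unique hA hdist ((hpq.conn.word hA).2 ▸ hlen.le) hqred
    (hpq.symm hA hdist) hqp hp hp'
  exact hpp.oneFlip_trans (hrp.symm hA hdist)

theorem TransAt.of_exists {n : ℕ} (hn : InjBelow A K n) {i j k : I}
    (h : ∀ q : List (I × K), q.length = n → IsRed A (word q) → Starts q j →
      invAct A (word q) (simple i) ≤ 0 → invAct A (word q) (simple k) ≤ 0 →
      ∃ p r, Starts p i ∧ Starts r k ∧ OneFlip A q p ∧ OneFlip A q r ∧ OneFlip A p r) :
    TransAt A K n i j k := by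
  intro p q r hlen hred hp hq hr hpq hqr
  have hqred := hpq.conn.isRed hA hred
  have hqlen : q.length = n := (hpq.conn.word hA).2 ▸ hlen
  obtain ⟨p', r', hp', hr', h1, h2, h3⟩ := h q hqlen hqred hq
    (by rw [← (hpq.conn.word hA).1]; exact hp.nonpos hA hred)
    (by rw [(hqr.conn.word hA).1]; exact hr.nonpos hA (hqr.conn.isRed hA hqred))
  have hpp := hn.oneFlip_unique hA hdist hqlen.le hqred (hpq.symm hA hdist) h1 hp hp'
  have hrr := hn.oneFlip_unique hA hdist hqlen.le hqred h2 hqr hr' hr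
  exact hpp.oneFlip_trans (h3.tailConn_trans hrr)

theorem TransAt.of_comm {n : ℕ} (hn : InjBelow A K n) {i j k : I} (hjk : A j k = 0)
    (hki : A k i = 0) (hij : A i j = 0) : TransAt A K n i j k := by
  have hji : A j i = 0 := by rw [← hA.symm, hij]
  have hik : A i k = 0 := by rw [← hA.symm, hki]
  refine .of_exists hA hdist hn fun q hlen hred hq hi hk => ?_
  obtain ⟨V, h1, h2⟩ := exists_append hA [j, i, k] ⟨hq.nonpos hA hred, by
    beta_reduce; rwa [sE_simple_comm hji], by
    beta_reduce; rwa [sE_simple_comm hik, sE_simple_comm hjk], trivial⟩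
  obtain ⟨q', hq', hc⟩ := exists_tailConn hA (g := i :: k :: V) hq hred h1
    (by simpa using h2)
  simp only [word_eq_cons] at hq'
  obtain ⟨a, _, rfl, b, _, rfl, c, V, rfl, -⟩ := hq'
  refine ⟨(i, b) :: (j, a) :: (k, c) :: V, (k, c) :: (j, a) :: (i, b) :: V, ⟨_, _, rfl⟩,
    ⟨_, _, rfl⟩, .inr ⟨_, _, hc, .comm hji _ _ _, ⟨_, _, _, rfl, rfl, .refl⟩⟩,
    .inr ⟨(j, a) :: (k, c) :: (i, b) :: V, _, hc.trans ⟨_, _, _, rfl, rfl, ?_⟩,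
      .comm hjk _ _ _, ⟨_, _, _, rfl, rfl, .refl⟩⟩,
    .inr ⟨(i, b) :: (k, c) :: (j, a) :: V, (k, c) :: (i, b) :: (j, a) :: V,
      ⟨_, _, _, rfl, rfl, ?_⟩, .comm hik _ _ _, ⟨_, _, _, rfl, rfl, ?_⟩⟩⟩
  · exact .single (.head (.comm hik _ _ _))
  · exact .single (.head (.comm hjk _ _ _))
  · exact .single (.head (.comm hij _ _ _))

theorem TransAt.of_adj {n : ℕ} (hn : InjBelow A K n) {i j k : I} (hjk : A j k = -1)
    (hij : A i j = 0) (hik : A i k = 0) : TransAt A K n i j k := by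
  have hji : A j i = 0 := by rw [← hA.symm, hij]
  have hki : A k i = 0 := by rw [← hA.symm, hik]
  have hkj : A k j = -1 := by rw [← hA.symm, hjk]
  refine .of_exists hA hdist hn fun q hlen hred hq hi hk => ?_
  have hj := hq.nonpos hA hred
  obtain ⟨V, h1, h2⟩ := exists_append hA [j, i, k, j] ⟨hj, by
    beta_reduce; rwa [sE_simple_comm hji], by
    beta_reduce
    rw [sE_simple_comm hik, sE_simple_adj hjk, invAct_add]
    exact add_nonpos hk hj, by
    beta_reduce
    rwa [sE_simple_adj hkj, sE_add, sE_simple_comm hij, sE_simple_comm hik, sE_add,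
      sE_simple_self hA, sE_simple_adj hjk, neg_add_cancel_comm_assoc], trivial⟩
  obtain ⟨q', hq', hc⟩ := exists_tailConn hA (g := i :: k :: j :: V) hq hred h1
    (by simpa using h2)
  simp only [word_eq_cons] at hq'
  obtain ⟨a, _, rfl, b, _, rfl, c, _, rfl, d, V, rfl, -⟩ := hq'
  refine ⟨(i, b) :: (j, a) :: (k, c) :: (j, d) :: V, _, ⟨_, _, rfl⟩, ⟨_, _, rfl⟩,
    .inr ⟨_, _, hc, .comm hji _ _ _, ⟨_, _, _, rfl, rfl, .refl⟩⟩,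
    .inr ⟨_, _, hc.trans ⟨_, _, (k, c) :: (j, d) :: (i, b) :: V, rfl, rfl, ?_⟩,
      .braid hjk _ _ _ _, ⟨_, _, _, rfl, rfl, .refl⟩⟩,
    .inr ⟨_, _, ⟨_, _, _, rfl, rfl, .single (.head (.braid hjk _ _ _ _))⟩, .comm hik _ _ _,
      ⟨_, _, _, rfl, rfl, ?_⟩⟩⟩
  · exact .head (.head (.comm hik _ _ _)) (.single (.cons _ (.head (.comm hij _ _ _))))
  · exact .head (.head (.comm hij _ _ _)) (.single (.cons _ (.head (.comm hik _ _ _))))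

theorem TransAt.of_adj_adj {n : ℕ} (hn : InjBelow A K n) {i j k : I} (hjk : A j k = -1)
    (hki : A k i = -1) (hij : A i j = 0) : TransAt A K n i j k := by
  have hji : A j i = 0 := by rw [← hA.symm, hij]
  have hik : A i k = -1 := by rw [← hA.symm, hki]
  have hkj : A k j = -1 := by rw [← hA.symm, hjk]
  refine .of_exists hA hdist hn fun q hlen hred hq hi hk => ?_
  have hj := hq.nonpos hA hred
  obtain ⟨V, h1, h2⟩ := exists_append hA [j, i, k, j, i, k] ⟨hj, by
      beta_reduce; rwa [sE_simple_comm hji], by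
      beta_reduce
      simp only [sE_simple_adj hik, sE_add, sE_simple_adj hjk, sE_simple_comm hji, invAct_add]
      exact add_nonpos (add_nonpos hk hj) hi, by
      beta_reduce
      simp only [sE_simple_adj hkj, sE_add, sE_simple_comm hij, sE_simple_adj hik,
        sE_simple_self hA, sE_simple_adj hjk, sE_simple_comm hji, invAct_add, invAct_neg]
      intro x
      have := hk x; have := hi x
      simp only [Pi.add_apply, Pi.neg_apply, Pi.zero_apply] at *
      linarith, by
      beta_reduce
      simp only [sE_simple_adj hki, sE_add, sE_simple_comm hji, sE_simple_adj hjk,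
        sE_simple_adj hik, sE_neg,
        sE_simple_self hA, invAct_add, invAct_neg]
      intro x
      have := hk x; have := hj x
      simp only [Pi.add_apply, Pi.neg_apply, Pi.zero_apply] at *
      linarith, by
      beta_reduce
      simp only [sE_simple_adj hki, sE_add, sE_simple_comm hji, sE_simple_adj hjk,
        sE_simple_adj hkj, sE_simple_comm hij, sE_simple_adj hik, sE_neg,
        sE_simple_self hA, invAct_add, invAct_neg]
      intro x
      have := hk x; have := hj x; have := hi x
      simp only [Pi.add_apply, Pi.neg_apply, Pi.zero_apply] at *
      linarith, trivial⟩
  obtain ⟨q', hq', hc⟩ := exists_tailConn hA (g := i :: k :: j :: i :: k :: V) hq hred h1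
    (by simpa using h2)
  simp only [word_eq_cons] at hq'
  obtain ⟨a, _, rfl, b, _, rfl, c, _, rfl, d, _, rfl, e, _, rfl, f, V, rfl, -⟩ := hq'
  obtain ⟨x1, hx1⟩ : ∃ x, x = c * e * (b + e)⁻¹ := ⟨_, rfl⟩
  obtain ⟨x2, hx2⟩ : ∃ x, x = b + e := ⟨_, rfl⟩
  obtain ⟨x3, hx3⟩ : ∃ x, x = b * c * (b + e)⁻¹ := ⟨_, rfl⟩
  obtain ⟨y1, hy1⟩ : ∃ x, x = d * f * (x3 + f)⁻¹ := ⟨_, rfl⟩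
  obtain ⟨y2, hy2⟩ : ∃ x, x = x3 + f := ⟨_, rfl⟩
  obtain ⟨y3, hy3⟩ : ∃ x, x = x3 * d * (x3 + f)⁻¹ := ⟨_, rfl⟩
  obtain ⟨z1, hz1⟩ : ∃ x, x = x1 * y1 * (a + y1)⁻¹ := ⟨_, rfl⟩
  obtain ⟨z2, hz2⟩ : ∃ x, x = a + y1 := ⟨_, rfl⟩
  obtain ⟨z3, hz3⟩ : ∃ x, x = a * x1 * (a + y1)⁻¹ := ⟨_, rfl⟩
  obtain ⟨w1, hw1⟩ : ∃ x, x = x2 * y2 * (z3 + y2)⁻¹ := ⟨_, rfl⟩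
  obtain ⟨w2, hw2⟩ : ∃ x, x = z3 + y2 := ⟨_, rfl⟩
  obtain ⟨w3, hw3⟩ : ∃ x, x = z3 * x2 * (z3 + y2)⁻¹ := ⟨_, rfl⟩
  obtain ⟨X1, hX1⟩ : ∃ x, x = c * d * (a + d)⁻¹ := ⟨_, rfl⟩
  obtain ⟨X2, hX2⟩ : ∃ x, x = a + d := ⟨_, rfl⟩
  obtain ⟨X3, hX3⟩ : ∃ x, x = a * c * (a + d)⁻¹ := ⟨_, rfl⟩
  obtain ⟨Y1, hY1⟩ : ∃ x, x = e * f * (X3 + f)⁻¹ := ⟨_, rfl⟩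
  obtain ⟨Y2, hY2⟩ : ∃ x, x = X3 + f := ⟨_, rfl⟩
  obtain ⟨Y3, hY3⟩ : ∃ x, x = X3 * e * (X3 + f)⁻¹ := ⟨_, rfl⟩
  obtain ⟨Z1, hZ1⟩ : ∃ x, x = X1 * Y1 * (b + Y1)⁻¹ := ⟨_, rfl⟩
  obtain ⟨Z2, hZ2⟩ : ∃ x, x = b + Y1 := ⟨_, rfl⟩
  obtain ⟨Z3, hZ3⟩ : ∃ x, x = b * X1 * (b + Y1)⁻¹ := ⟨_, rfl⟩
  obtain ⟨W1, hW1⟩ : ∃ x, x = X2 * Y2 * (Z3 + Y2)⁻¹ := ⟨_, rfl⟩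
  obtain ⟨W2, hW2⟩ : ∃ x, x = Z3 + Y2 := ⟨_, rfl⟩
  obtain ⟨W3, hW3⟩ : ∃ x, x = Z3 * X2 * (Z3 + Y2)⁻¹ := ⟨_, rfl⟩
  obtain ⟨h1, h2, h3, h4, h5, h6⟩ := braid_hexagon hdist hx1 hx2 hx3 hy1 hy2 hy3 hz1 hz2 hz3
    hw1 hw2 hw3 hX1 hX2 hX3 hY1 hY2 hY3 hZ1 hZ2 hZ3 hW1 hW2 hW3
  have move {i j : I} (h : A i j = -1) {a b c x y z : K} (hx : x = b * c * (a + c)⁻¹)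
      (hy : y = a + c) (hz : z = a * b * (a + c)⁻¹) (t : List (I × K)) :
      Flip A ((i, a) :: (j, b) :: (i, c) :: t) ((j, x) :: (i, y) :: (j, z) :: t) := by
    subst hx hy hz
    exact .braid h a b c t
  refine ⟨(i, b) :: (j, a) :: (k, c) :: (j, d) :: (i, e) :: (k, f) :: V,
    (k, z1) :: (j, z2) :: (k, z3) :: (i, x2) :: (k, y2) :: (j, y3) :: V,
    ⟨_, _, rfl⟩, ⟨_, _, rfl⟩,
    .inr ⟨_, _, hc, .comm hji _ _ _, ⟨_, _, _, rfl, rfl, .refl⟩⟩,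
    .inr ⟨_, _, hc.trans ⟨_, _, (k, x1) :: (j, y1) :: (i, x2) :: (k, y2) :: (j, y3) :: V,
      rfl, rfl, ?_⟩, move hjk hz1 hz2 hz3 _, ⟨_, _, _, rfl, rfl, .refl⟩⟩,
    .inr ⟨_, (k, Z1) :: (i, Z2) :: (k, Z3) :: (j, X2) :: (k, Y2) :: (i, Y3) :: V,
      ⟨_, _, (k, X1) :: (i, Y1) :: (j, X2) :: (k, Y2) :: (i, Y3) :: V, rfl, rfl, ?_⟩,
      move hik hZ1 hZ2 hZ3 _, ⟨(k, z1), (i, Z2) :: (k, Z3) :: (j, X2) :: (k, Y2) :: (i, Y3) :: V,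
        _, by rw [h1], rfl, ?_⟩⟩⟩
  · refine .head (.cons _ (.cons _ (.head (.comm hji _ _ _)))) ?_
    refine .head (.head (move hik hx1 hx2 hx3 _)) ?_
    refine .head (.cons _ (.cons _ (.head (move hkj hy1 hy2 hy3 _)))) ?_
    exact .single (.cons _ (.head (.comm hij _ _ _)))
  · refine .head (.head (move hjk hX1 hX2 hX3 _)) ?_
    refine .head (.cons _ (.cons _ (.head (move hki hY1 hY2 hY3 _)))) ?_
    exact .single (.cons _ (.head (.comm hji _ _ _)))
  · refine .head (.cons _ (.head (move hkj hW1 hW2 hW3 _))) ?_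
    refine .head (.head (.comm hij _ _ _)) ?_
    refine .head (.cons _ (.cons _ (.cons _ (.head (.comm hji _ _ _))))) ?_
    subst h2 h3 h4 h5 h6
    exact .single (.cons _ (.head ((move hki hw1 hw2 hw3 _).symm hA hdist)))

theorem TransAt.of_ne {n : ℕ} (hn : InjBelow A K n) {i j k : I} (hij : i ≠ j) (hjk : j ≠ k)
    (hki : k ≠ i) : TransAt A K n i j k := by
  rcases hA.offDiag j k hjk with h1 | h1 <;> rcases hA.offDiag k i hki with h2 | h2 <;>
    rcases hA.offDiag i j hij with h3 | h3
  · exact .of_comm hA hdist hn h1 h2 h3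
  · exact (TransAt.of_adj hA hdist hn h3 h2 (by rw [← hA.symm, h1])).rotate hA hdist hn hki hij
  · exact ((TransAt.of_adj hA hdist hn h2 h1 (by rw [← hA.symm, h3])).rotate hA hdist hn hjk
      hki).rotate hA hdist hn hki hij
  · exact ((TransAt.of_adj_adj hA hdist hn h2 h3 h1).rotate hA hdist hn hjk hki).rotate hA hdist hn
      hki hij
  · exact .of_adj hA hdist hn h1 h3 (by rw [← hA.symm, h2])
  · exact (TransAt.of_adj_adj hA hdist hn h3 h1 h2).rotate hA hdist hn hki hij
  · exact .of_adj_adj hA hdist hn h1 h2 h3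
  · exfalso
    have h : form A (simple i + simple j + simple k) (simple i + simple j + simple k) = 0 := by
      simp only [form_add_left, form_add_right, form_simple_simple, hA.diag, hA.symm j i,
        hA.symm k j, hA.symm i k, h1, h2, h3]
      norm_num
    have h0 : simple i + simple j + simple k ≠ (0 : I → ℤ) := by
      intro h
      have := congrFun h i
      simp [hij, hki.symm] at this
    have := two_le_form_self hA h0
    omega

omit [Fintype I] [DecidableEq I] hA hdist in
theorem OneFlip.exists_starts {p q : List (I × K)} (h : OneFlip A p q) : ∃ i, Starts p i := by
  rcases h with ⟨⟨i, a⟩, t, t', rfl, rfl, h⟩ | ⟨p', q', ⟨⟨i, a⟩, t, t', rfl, rfl, h⟩, -, -⟩ <;>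
  exact ⟨_, _, _, rfl⟩

theorem InjBelow.oneFlip_trans {n : ℕ} (hn : InjBelow A K n) {p q r : List (I × K)}
    (hlen : p.length = n) (hred : IsRed A (word p)) (hpq : OneFlip A p q) (hqr : OneFlip A q r) :
    OneFlip A p r := by
  obtain ⟨i, hi⟩ := hpq.exists_starts
  obtain ⟨j, hj⟩ := hqr.exists_starts
  obtain ⟨k, hk⟩ := (hqr.symm hA hdist).exists_starts
  by_cases hij : i = j
  · subst hij
    exact (hpq.tailConn hA hdist hi hj).oneFlip_trans hqr
  by_cases hjk : j = k
  · subst hjk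
    exact hpq.tailConn_trans (hqr.tailConn hA hdist hj hk)
  by_cases hki : k = i
  · subst hki
    exact .inl (hn.oneFlip_unique hA hdist ((hpq.conn.word hA).2 ▸ hlen.le)
      (hpq.conn.isRed hA hred) (hpq.symm hA hdist) hqr hi hk)
  exact TransAt.of_ne hA hdist hn hij hjk hki p q r hlen hred hi hj hk hpq hqr

omit [Fintype I] [DecidableEq I] hA hdist in
theorem Move.oneFlip {p q : List (I × K)} (h : Move A p q) : OneFlip A p q := by
  cases h with
  | head h =>
    refine .inr ⟨p, q, ?_, h, ?_⟩ <;> cases h <;> exact ⟨_, _, _, rfl, rfl, .refl⟩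
  | cons x h => exact .inl ⟨_, _, _, rfl, rfl, .single h⟩

/-- Connected reduced decorated words with the same underlying word are equal. -/
theorem Conn.eq_of_word_eq {p q : List (I × K)} (hp : IsRed A (Lusztig.word p))
    (h : Conn A p q) (hpq : Lusztig.word p = Lusztig.word q) : p = q := by
  suffices hn : ∀ n, InjBelow A K n from hn _ p q (Nat.lt_succ_self _) hp h hpq
  intro n
  induction n with
  | zero => exact fun _ _ h => (Nat.not_lt_zero _ h).elim
  | succ n ih =>
    intro p q hlen hred h hpq
    rcases Nat.lt_succ_iff_lt_or_eq.1 hlen with hlen | hlen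
    · exact ih p q hlen hred h hpq
    rcases p with _ | ⟨⟨i, a⟩, t⟩
    · exact (List.map_eq_nil_iff.1 hpq.symm).symm
    obtain ⟨b, u, rfl, hu⟩ := word_eq_cons.1 hpq.symm
    have h1 : ∀ q, Conn A ((i, a) :: t) q → OneFlip A ((i, a) :: t) q := by
      intro q h
      induction h with
      | refl => exact .inl ⟨_, _, _, rfl, rfl, .refl⟩
      | tail _ hm ih' => exact ih.oneFlip_trans hA hdist hlen hred ih' hm.oneFlip
    obtain ⟨x, t', u', h2, h3, h4⟩ := (h1 _ h).tailConn hA hdist ⟨_, _, rfl⟩ ⟨_, _, rfl⟩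
    obtain ⟨rfl, rfl⟩ := List.cons.inj h2
    obtain ⟨h5, rfl⟩ := List.cons.inj h3
    rw [h5, ih t u (by rw [← hlen]; exact Nat.lt_succ_self _) hred.tail h4 hu.symm]

end Semifield

end Moves

section Sequences

variable {A : Matrix I I ℤ}

theorem prod_invAct (hA : IsSimplyLacedCartan A) (l : List I) (x : I → ℤ) :
    (l.map (sE A)).prod (invAct A l x) = x := by
  induction l generalizing x with
  | nil => rfl
  | cons i t ih =>
    rw [List.map_cons, List.prod_cons, invAct]
    exact (congrArg (sE A i) (ih _)).trans (sE_sE hA i x)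

theorem invAct_prod (hA : IsSimplyLacedCartan A) (l : List I) (x : I → ℤ) :
    invAct A l ((l.map (sE A)).prod x) = x := by
  induction l generalizing x with
  | nil => rfl
  | cons i t ih =>
    rw [List.map_cons, List.prod_cons, invAct]
    exact (congrArg (invAct A t) (sE_sE hA i _)).trans (ih x)

theorem prod_eq_iff_invAct_eq (hA : IsSimplyLacedCartan A) {l l' : List I} :
    (l.map (sE A)).prod = (l'.map (sE A)).prod ↔ invAct A l = invAct A l' := by
  refine ⟨fun h => funext fun x => ?_, fun h => funext fun x => ?_⟩
  · rw [← invAct_prod hA l' (invAct A l x), ← h, prod_invAct hA]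
  · rw [← prod_invAct hA l' ((l.map (sE A)).prod x), ← h, invAct_prod hA]

variable {K : Type*} {ν : ℕ}

/-- The decorated word given by a sequence of letters and a sequence of parameters. -/
def decorate (p : (Fin ν → I) × (Fin ν → K)) : List (I × K) :=
  List.ofFn fun k => (p.1 k, p.2 k)

omit [Fintype I] [DecidableEq I] in
theorem word_decorate (p : (Fin ν → I) × (Fin ν → K)) : word (decorate p) = List.ofFn p.1 := by
  rw [word, decorate, List.map_ofFn]
  rfl

omit [Fintype I] [DecidableEq I] in
theorem length_decorate (p : (Fin ν → I) × (Fin ν → K)) : (decorate p).length = ν := by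
  simp [decorate]

omit [Fintype I] [DecidableEq I] in
theorem getElem?_decorate (p : (Fin ν → I) × (Fin ν → K)) {k : ℕ} (hk : k < ν) :
    (decorate p)[k]? = some (p.1 ⟨k, hk⟩, p.2 ⟨k, hk⟩) := by
  simp [decorate, hk]

omit [Fintype I] [DecidableEq I] in
theorem exists_eq_decorate {L : List (I × K)} (h : L.length = ν) :
    ∃ p : (Fin ν → I) × (Fin ν → K), L = decorate p := by
  subst h
  exact ⟨(fun k => L[k].1, fun k => L[k].2), List.ofFn_getElem.symm⟩

omit [Fintype I] [DecidableEq I] in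
theorem decorate_injective :
    Function.Injective (decorate : (Fin ν → I) × (Fin ν → K) → List (I × K)) := by
  intro p q h
  have h := congrFun (List.ofFn_injective h)
  exact Prod.ext (funext fun k => congrArg Prod.fst (h k)) (funext fun k => congrArg Prod.snd (h k))

variable {w₀ : Function.End (I → ℤ)}

theorem isRed_decorate (hA : IsSimplyLacedCartan A) (hw : IsLongest A w₀ ν)
    {p : (Fin ν → I) × (Fin ν → K)} (hp : p.1 ∈ RedWord A w₀ ν) :
    IsRed A (word (decorate p)) := by
  intro l hl
  rw [word_decorate] at hl ⊢
  rw [List.length_ofFn, ← hw.len_eq]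
  exact Nat.sInf_le ⟨l, rfl, ((prod_eq_iff_invAct_eq hA).2 hl).trans hp⟩

variable [CommGroup K] [AddCommSemigroup K]

omit [Fintype I] [DecidableEq I] in
theorem Move.append (u : List (I × K)) {x y : List (I × K)} (h : Flip A x y) :
    Move A (u ++ x) (u ++ y) := by
  induction u with
  | nil => exact .head h
  | cons z u ih => exact .cons z ih

omit [Fintype I] [DecidableEq I] in
theorem Move.exists_append {p q : List (I × K)} (h : Move A p q) :
    ∃ u x y, p = u ++ x ∧ q = u ++ y ∧ Flip A x y := by
  induction h with
  | head h => exact ⟨[], _, _, rfl, rfl, h⟩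
  | cons z h ih =>
    obtain ⟨u, x, y, rfl, rfl, h1⟩ := ih
    exact ⟨z :: u, x, y, rfl, rfl, h1⟩

omit [Fintype I] [DecidableEq I] [CommGroup K] [AddCommSemigroup K] in
theorem take_decorate_eq {p q : (Fin ν → I) × (Fin ν → K)} {l : ℕ}
    (h : ∀ k : Fin ν, (k : ℕ) < l → q.1 k = p.1 k ∧ q.2 k = p.2 k) :
    (decorate q).take l = (decorate p).take l := by
  refine List.ext_getElem (by simp [length_decorate]) fun k h1 h2 => ?_
  simp only [List.length_take, length_decorate, lt_inf_iff] at h1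
  simp [decorate, h ⟨k, h1.2⟩ h1.1]

omit [Fintype I] [DecidableEq I] [CommGroup K] [AddCommSemigroup K] in
theorem drop_decorate_eq {p q : (Fin ν → I) × (Fin ν → K)} {l : ℕ}
    (h : ∀ k : Fin ν, l ≤ (k : ℕ) → q.1 k = p.1 k ∧ q.2 k = p.2 k) :
    (decorate q).drop l = (decorate p).drop l := by
  refine List.ext_getElem (by simp [length_decorate]) fun k h1 h2 => ?_
  simp only [List.length_drop, length_decorate] at h1
  simp [decorate, h ⟨l + k, by omega⟩ (by simp)]

omit [Fintype I] [DecidableEq I] [CommGroup K] [AddCommSemigroup K] in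
theorem drop_decorate (p : (Fin ν → I) × (Fin ν → K)) {l : ℕ} (hl : l < ν) :
    (decorate p).drop l = (p.1 ⟨l, hl⟩, p.2 ⟨l, hl⟩) :: (decorate p).drop (l + 1) := by
  rw [List.drop_eq_getElem_cons (by rwa [length_decorate])]
  simp [decorate]

theorem Adjacent.move {p q : (Fin ν → I) × (Fin ν → K)} (h : Adjacent A w₀ ν p q) :
    Move A (decorate p) (decorate q) := by
  obtain ⟨-, -, ⟨l, h0, h1, h2, hA, e1, e2, e3, e4, e, f1, f2, f3⟩ |
    ⟨l, h0, h1, hA, e2, e3, e, f1, f2⟩⟩ := h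
  · rw [← List.take_append_drop l (decorate p), ← List.take_append_drop l (decorate q),
      take_decorate_eq fun k hk => e k (by omega) (by omega) (by omega),
      drop_decorate p h0, drop_decorate p h1, drop_decorate p h2, drop_decorate q h0,
      drop_decorate q h1, drop_decorate q h2,
      drop_decorate_eq fun k hk => e k (by omega) (by omega) (by omega), e1, e2, e3, e4, f1, f2, f3]
    exact .append _ (.braid hA _ _ _ _)
  · rw [← List.take_append_drop l (decorate p), ← List.take_append_drop l (decorate q),
      take_decorate_eq fun k hk => e k (by omega) (by omega),
      drop_decorate p h0, drop_decorate p h1, drop_decorate q h0, drop_decorate q h1,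
      drop_decorate_eq fun k hk => e k (by omega) (by omega), e2, e3, f1, f2]
    exact .append _ (.comm hA _ _ _)

theorem Move.adjacent (hA : IsSimplyLacedCartan A) {p q : (Fin ν → I) × (Fin ν → K)}
    (hp : p.1 ∈ RedWord A w₀ ν) (h : Move A (decorate p) (decorate q)) : Adjacent A w₀ ν p q := by
  have hq : q.1 ∈ RedWord A w₀ ν := by
    have := (h.word hA).1
    rw [word_decorate, word_decorate, ← prod_eq_iff_invAct_eq hA] at this
    exact this.symm.trans hp
  refine ⟨hp, hq, ?_⟩
  obtain ⟨u, x, y, hx, hy, h⟩ := h.exists_append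
  have hpl : (u ++ x).length = ν := hx ▸ length_decorate p
  have gp {k : ℕ} (hk : k < ν) := getElem?_decorate p hk
  have gq {k : ℕ} (hk : k < ν) := getElem?_decorate q hk
  rw [hx] at gp
  rw [hy] at gq
  have eq_of_getElem? (k : Fin ν) (hk : (u ++ x)[(k : ℕ)]? = (u ++ y)[(k : ℕ)]?) :
      q.1 k = p.1 k ∧ q.2 k = p.2 k := by
    simpa using (gq k.2).symm.trans (hk.symm.trans (gp k.2))
  cases h with
  | @braid i j hij a b c t =>
    simp only [List.length_append, List.length_cons] at hpl
    have p0 := gp (k := u.length) (by omega)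
    have p1 := gp (k := u.length + 1) (by omega)
    have p2 := gp (k := u.length + 2) (by omega)
    have q0 := gq (k := u.length) (by omega)
    have q1 := gq (k := u.length + 1) (by omega)
    have q2 := gq (k := u.length + 2) (by omega)
    simp at p0 p1 p2 q0 q1 q2
    refine .inl ⟨u.length, by omega, by omega, by omega, ?_⟩
    simp only [← p0, ← p1, ← p2, ← q0, ← q1, ← q2, true_and, and_true]
    refine ⟨hij, fun k h0 h1 h2 => ?_⟩
    rcases lt_or_gt_of_ne h0 with h0 | h0
    · exact eq_of_getElem? k (by simp [List.getElem?_append_left h0])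
    · obtain ⟨m, hm⟩ : ∃ m, (k : ℕ) = u.length + (m + 3) := ⟨k - u.length - 3, by omega⟩
      refine eq_of_getElem? k ?_
      rw [hm, List.getElem?_append_right (by omega), List.getElem?_append_right (by omega),
        Nat.add_sub_cancel_left]
      rfl
  | @comm i j hij a b t =>
    simp only [List.length_append, List.length_cons] at hpl
    have p0 := gp (k := u.length) (by omega)
    have p1 := gp (k := u.length + 1) (by omega)
    have q0 := gq (k := u.length) (by omega)
    have q1 := gq (k := u.length + 1) (by omega)
    simp at p0 p1 q0 q1
    refine .inr ⟨u.length, by omega, by omega, ?_⟩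
    simp only [← p0, ← p1, ← q0, ← q1, true_and, and_true]
    refine ⟨hij, fun k h0 h1 => ?_⟩
    rcases lt_or_gt_of_ne h0 with h0 | h0
    · exact eq_of_getElem? k (by simp [List.getElem?_append_left h0])
    · obtain ⟨m, hm⟩ : ∃ m, (k : ℕ) = u.length + (m + 2) := ⟨k - u.length - 2, by omega⟩
      refine eq_of_getElem? k ?_
      rw [hm, List.getElem?_append_right (by omega), List.getElem?_append_right (by omega),
        Nat.add_sub_cancel_left]
      rfl

theorem eqvGen_adjacent_conn (hA : IsSimplyLacedCartan A)
    (hdist : ∀ a b c : K, a * (b + c) = a * b + a * c) {p q : (Fin ν → I) × (Fin ν → K)}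
    (h : Relation.EqvGen (Adjacent A w₀ ν) p q) : Conn A (decorate p) (decorate q) := by
  induction h with
  | rel p q h => exact .single h.move
  | refl p => exact .refl
  | symm p q h ih => exact ih.symm hA hdist
  | trans p q r h h' ih ih' => exact ih.trans ih'

theorem Conn.eqvGen_adjacent (hA : IsSimplyLacedCartan A) {p : (Fin ν → I) × (Fin ν → K)}
    (hp : p.1 ∈ RedWord A w₀ ν) {L : List (I × K)} (h : Conn A (decorate p) L) :
    ∃ q, L = decorate q ∧ q.1 ∈ RedWord A w₀ ν ∧ Relation.EqvGen (Adjacent A w₀ ν) p q := by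
  induction h with
  | refl => exact ⟨p, rfl, hp, .refl p⟩
  | tail h hm ih =>
    obtain ⟨q, rfl, hq, h1⟩ := ih
    obtain ⟨r, rfl⟩ := exists_eq_decorate ((hm.word hA).2.symm.trans (length_decorate q))
    have h2 := hm.adjacent hA hq
    exact ⟨r, rfl, h2.2.1, h1.trans _ _ _ (.rel _ _ h2)⟩

end Sequences

/-- for `f ∈ ℐ`, the map `f_f : K^ν → 𝒰_K`, `a ↦ class of (f,a)`,
is a bijection: it is injective (equivalent pairs with the same word `f` have
equal parameters) and surjective (every class has a representative with word `f`). -/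
theorem param_bijective (A : Matrix I I ℤ) (hA : IsSimplyLacedCartan A)
    (w₀ : Function.End (I → ℤ)) (ν : ℕ) (hw : IsLongest A w₀ ν)
    {K : Type*} [CommGroup K] [AddCommSemigroup K]
    (hdist : ∀ a b c : K, a * (b + c) = a * b + a * c)
    (f : Fin ν → I) (hf : f ∈ RedWord A w₀ ν) :
    (∀ a a' : Fin ν → K,
      Relation.EqvGen (Adjacent A w₀ ν) (f, a) (f, a') → a = a') ∧
    (∀ p : (Fin ν → I) × (Fin ν → K), p.1 ∈ RedWord A w₀ ν →
      ∃ a : Fin ν → K, Relation.EqvGen (Adjacent A w₀ ν) (f, a) p) := by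
  refine ⟨fun a a' h => ?_, fun p hp => ?_⟩
  · have h1 := (eqvGen_adjacent_conn hA hdist h).eq_of_word_eq hA hdist
      (isRed_decorate hA hw (p := (f, a)) hf) (by rw [word_decorate, word_decorate])
    exact congrArg Prod.snd (decorate_injective h1)
  · obtain ⟨q, hq, hc⟩ := exists_conn hA (decorate p) (isRed_decorate hA hw hp) (List.ofFn f)
      (by rw [word_decorate, ← prod_eq_iff_invAct_eq hA]; exact hf.trans hp.symm)
      (by rw [List.length_ofFn, length_decorate])
    obtain ⟨⟨g, a⟩, rfl, -, h⟩ := hc.eqvGen_adjacent hA hp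
    rw [word_decorate] at hq
    obtain rfl : g = f := List.ofFn_injective hq
    exact ⟨a, h.symm _ _⟩

end Lusztig
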